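/- Suppose β = 0 (pure exclusion) and p > 1/2. Then for every initial configuration S₀ ∈ 𝒟 and every s ∈ [0,∞), the relaxation time of the discrete-time exclusion-voter chain satisfies E_{0,p}[τ^{s} | ξ₀ = S₀] < ∞. -/

import Mathlib

open MeasureTheory Filter
open scoped ENNReal NNReal

namespace EV

/-- A configuration of the exclusion-voter model is the finite hybrid-zone word
(`false` = 0, `true` = 1); the full two-sided configuration is `1^∞ w 0^∞`. -/
abbrev Word := List Bool

/-- Canonical (normalized) words: empty (the ground state `𝒟₀`) or starting with
a `0` and ending with a `1`; these are in bijection with the configuration space `𝒟`. -/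
def IsConfig (w : Word) : Prop :=
  w = [] ∨ (w.head? = some false ∧ w.getLast? = some true)

/-- The ground-state Heaviside configuration `𝒟₀ = …111000…`. -/
def groundState : Word := []

/-- Pad a word with one boundary symbol of the adjacent infinite block on each side. -/
def pad (w : Word) : Word := true :: (w ++ [false])

/-- Normalize: strip leading `1`s (they merge into the left infinite block of `1`s)
and trailing `0`s (they merge into the right infinite block of `0`s). -/
def strip (w : Word) : Word :=
  ((w.dropWhile (· = true)).reverse.dropWhile (· = false)).reverse

def setPair (w : Word) (i : ℕ) (a b : Bool) : Word := (w.set i a).set (i + 1) b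

def swapPair (w : Word) (i : ℕ) : Word :=
  setPair w i (w.getD (i + 1) true) (w.getD i true)

/-- Indices of the unlike adjacent pairs (`01` or `10`), read off the padded word. -/
def unlike (w : Word) : List ℕ :=
  (List.range (w.length + 1)).filter
    (fun i => (pad w).getD i true ≠ (pad w).getD (i + 1) true)

/-- One-step transition kernel of the discrete-time exclusion-voter chain with mixing
parameter `β` and exclusion parameter `p`: an unlike adjacent pair is chosen uniformly
at random; with probability `β` a voter move flips the pair to `00` or `11` (each with
probability `1/2`); with probability `1-β` an exclusion move swaps a `01` with
probability `p` and a `10` with probability `1-p` (otherwise no change). -/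
noncomputable def P (β p : ℝ) (w w' : Word) : ℝ :=
  ((unlike w).map (fun i =>
    let a := (pad w).getD i true
    let swapProb := if a then 1 - p else p
    ((unlike w).length : ℝ)⁻¹ *
      (β * (1 / 2) * (if strip (setPair (pad w) i false false) = w' then 1 else 0)
       + β * (1 / 2) * (if strip (setPair (pad w) i true true) = w' then 1 else 0)
       + (1 - β) * swapProb * (if strip (swapPair (pad w) i) = w' then 1 else 0)
       + (1 - β) * (1 - swapProb) * (if w = w' then 1 else 0)))).sum

/-- `n`-step transition probabilities. -/
noncomputable def Pn (β p : ℝ) : ℕ → Word → Word → ℝ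
  | 0 => fun w w' => if w = w' then 1 else 0
  | n + 1 => fun w w' => ∑' z : Word, Pn β p n w z * P β p z w'

/-- `w'` is accessible from `w`: some `n`-step transition probability is positive. -/
def Accessible (β p : ℝ) (w w' : Word) : Prop :=
  ∃ n : ℕ, 0 < n ∧ 0 < Pn β p n w w'

/-- Two states communicate: each is accessible from the other. -/
def Communicate (β p : ℝ) (w w' : Word) : Prop :=
  Accessible β p w w' ∧ Accessible β p w' w

instance : MeasurableSpace Word := ⊤

/-- `ξ` is (a realization of) the discrete-time exclusion-voter Markov chain with
parameters `(β, p)` under the probability measure `μ`. -/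
def IsEVChain (β p : ℝ) {Ω : Type*} [MeasurableSpace Ω] (μ : Measure Ω)
    (ξ : ℕ → Ω → Word) : Prop :=
  (∀ t, Measurable (ξ t)) ∧
  ∀ (t : ℕ) (path : ℕ → Word),
    μ {ω | ∀ i ≤ t + 1, ξ i ω = path i}
      = μ {ω | ∀ i ≤ t, ξ i ω = path i} * ENNReal.ofReal (P β p (path t) (path (t + 1)))

/-- The relaxation time `τ = min {t ∈ ℕ, t ≥ 1 : ξ_t = 𝒟₀}` (`∞` if there is no such `t`). -/
noncomputable def relaxTime {Ω : Type*} (ξ : ℕ → Ω → Word) (ω : Ω) : ℝ≥0∞ :=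
  sInf {r : ℝ≥0∞ | ∃ t : ℕ, 0 < t ∧ ξ t ω = groundState ∧ r = (t : ℝ≥0∞)}

/-- The size `|S|` of the hybrid zone. -/
def hz (w : Word) : ℕ := w.length

/-- The number of blocks `N(S)`: the number of (finite) `1`-blocks of the hybrid zone. -/
def nb (w : Word) : ℕ :=
  ((Finset.range w.length).filter
    (fun b => w.getD b false = true ∧ (b = 0 ∨ w.getD (b - 1) true = false))).card

/-- Number of `0`s among the first `c` positions of the hybrid zone. -/
def z0 (w : Word) (c : ℕ) : ℕ :=
  ((Finset.range c).filter (fun a => w.getD a true = false)).card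

/-- Number of `1`s of the hybrid zone at positions `≥ c`. -/
def o1 (w : Word) (c : ℕ) : ℕ :=
  ((Finset.Ico c w.length).filter (fun b => w.getD b false = true)).card

/-- `f₁(S) = Σᵢ mᵢ Rᵢ = Σᵢ nᵢ Tᵢ`: each `1` contributes the number of `0`s to its left. -/
def f1 (w : Word) : ℕ :=
  ∑ b ∈ (Finset.range w.length).filter (fun b => w.getD b false = true), z0 w b

/-- `f₂(S) = (1/2)(Σᵢ mᵢ Rᵢ² + Σᵢ nᵢ Tᵢ²)`: each `1` contributes the squared number of
`0`s to its left, each `0` the squared number of `1`s to its right. -/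
noncomputable def f2 (w : Word) : ℝ :=
  (1 / 2) *
    ((∑ b ∈ (Finset.range w.length).filter (fun b => w.getD b false = true),
        ((z0 w b : ℝ)) ^ 2)
     + (∑ a ∈ (Finset.range w.length).filter (fun a => w.getD a true = false),
        ((o1 w (a + 1) : ℝ)) ^ 2))

/-- `g(S) = max_{1 ≤ k ≤ N} R_k T_k`: the maximum over the `01`-corners of
(number of `0`s up to the corner) × (number of `1`s after the corner). -/
def gfun (w : Word) : ℕ :=
  ((Finset.range w.length).filter
    (fun a => w.getD a true = false ∧ w.getD (a + 1) false = true)).sup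
    (fun a => z0 w (a + 1) * o1 w (a + 1))

/-- `φ₁(S) = Σᵢ Σ_{j=R_{i-1}+1}^{R_i} Σ_{k=1}^{T_i} 1/(j+k)`: the `j`-th `0` (at position `a`,
so `j = z0 w (a+1)`) contributes `Σ_{k=1}^{T} 1/(j+k)` with `T` the number of `1`s to its right. -/
noncomputable def phi1 (w : Word) : ℝ :=
  ∑ a ∈ (Finset.range w.length).filter (fun a => w.getD a true = false),
    ∑ k ∈ Finset.Icc 1 (o1 w (a + 1)), (1 : ℝ) / ((z0 w (a + 1) : ℝ) + (k : ℝ))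

/-- The number of inversions `01` (not necessarily adjacent) of a word. -/
def inv : Word → ℕ
  | [] => 0
  | true :: l => inv l
  | false :: l => inv l + l.count true

/-- The sum over the `1`s of the squared number of `0`s to the left plus the sum over the `0`s of
the squared number of `1`s to the right. -/
def energy : Word → ℕ
  | [] => 0
  | true :: l => energy l
  | false :: l => energy l + (l.count true) ^ 2 + 2 * inv l + l.count true

lemma inv_append (a b : Word) : inv (a ++ b) = inv a + inv b + a.count false * b.count true := by
  induction a with
  | nil => simp [inv]
  | cons x a ih => cases x <;> (simp [inv, ih]; try ring)

lemma energy_append (a b : Word) :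
    energy (a ++ b) = energy a + energy b + 2 * inv a * b.count true
      + a.count false * (b.count true) ^ 2 + 2 * a.count false * inv b
      + (a.count false) ^ 2 * b.count true := by
  induction a with
  | nil => simp [energy, inv]
  | cons x a ih => cases x <;> (simp [inv, energy, ih, inv_append]; try ring)

lemma inv_replicate (n : ℕ) (x : Bool) : inv (List.replicate n x) = 0 := by
  induction n with
  | zero => simp [inv]
  | succ n ih => cases x <;> simp_all [inv, List.replicate_succ, List.count_replicate]

lemma energy_replicate (n : ℕ) (x : Bool) : energy (List.replicate n x) = 0 := by
  induction n with
  | zero => simp [energy]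
  | succ n ih =>
    cases x <;> simp_all [energy, List.replicate_succ, inv_replicate, List.count_replicate]

lemma eq_replicate_append_dropWhile (x : Bool) (l : Word) :
    ∃ n, l = List.replicate n x ++ l.dropWhile (· = x) := by
  induction l with
  | nil => exact ⟨0, rfl⟩
  | cons y l ih =>
    obtain ⟨n, hn⟩ := ih
    by_cases h : y = x
    · refine ⟨n + 1, ?_⟩
      rw [List.dropWhile_cons_of_pos (by simpa using h), List.replicate_succ, List.cons_append, ← hn,
        h]
    · exact ⟨0, by simp [h]⟩

lemma eq_replicate_append_strip (l : Word) :
    ∃ m n, l = List.replicate m true ++ strip l ++ List.replicate n false := by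
  obtain ⟨m, hm⟩ := eq_replicate_append_dropWhile true l
  obtain ⟨n, hn⟩ := eq_replicate_append_dropWhile false (l.dropWhile (· = true)).reverse
  refine ⟨m, n, ?_⟩
  have h := congrArg List.reverse hn
  rw [List.reverse_reverse, List.reverse_append, List.reverse_replicate] at h
  rw [List.append_assoc]
  exact hm.trans (congrArg _ h)

lemma inv_strip (l : Word) : inv (strip l) = inv l := by
  obtain ⟨m, n, h⟩ := eq_replicate_append_strip l
  conv_rhs => rw [h]
  simp [inv_append, inv_replicate, List.count_replicate]

lemma energy_strip (l : Word) : energy (strip l) = energy l := by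
  obtain ⟨m, n, h⟩ := eq_replicate_append_strip l
  conv_rhs => rw [h]
  simp [energy_append, energy_replicate, inv_replicate, inv_append, List.count_replicate]

lemma inv_pad (w : Word) : inv (pad w) = inv w := by
  simp [pad, inv, inv_append]

lemma energy_pad (w : Word) : energy (pad w) = energy w := by
  simp [pad, energy, energy_append, inv]

lemma isConfig_strip (l : Word) : IsConfig (strip l) := by
  by_cases h : strip l = []
  · exact Or.inl h
  · refine Or.inr ⟨?_, ?_⟩
    · obtain ⟨n, hn⟩ := eq_replicate_append_dropWhile false (l.dropWhile (· = true)).reverse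
      have h' := congrArg List.reverse hn
      rw [List.reverse_reverse, List.reverse_append, List.reverse_replicate] at h'
      have h1 : (l.dropWhile (· = true)).head? = (strip l).head? := by
        rw [h']
        exact List.head?_append_of_ne_nil _ h
      have h2 : l.dropWhile (· = true) ≠ [] := by
        intro h3
        exact h (by rw [strip, h3]; rfl)
      have h3 := List.head_dropWhile_not (fun x : Bool => decide (x = true)) h2
      rw [← h1, List.head?_eq_some_head h2]
      simpa using h3
    · have h2 : (l.dropWhile (· = true)).reverse.dropWhile (· = false) ≠ [] := by
        intro h3
        exact h (by rw [strip, h3]; rfl)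
      have h3 := List.head_dropWhile_not (fun x : Bool => decide (x = false)) h2
      rw [strip, List.getLast?_reverse, List.head?_eq_some_head h2]
      simpa using h3

lemma exists_of_isConfig {w : Word} (hw : IsConfig w) (h : w ≠ []) :
    ∃ m : Word, w = false :: (m ++ [true]) := by
  obtain ⟨h1, h2⟩ := hw.resolve_left h
  obtain ⟨t, rfl⟩ : ∃ t, w = false :: t := by
    cases w with
    | nil => simp at h1
    | cons x t => exact ⟨t, by simpa using h1⟩
  rcases List.eq_nil_or_concat t with rfl | ⟨m, x, rfl⟩
  · simp at h2
  · refine ⟨m, ?_⟩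
    rw [List.concat_eq_append, ← List.cons_append, List.getLast?_concat] at h2
    simp_all

lemma sq_length_le_energy {w : Word} (hw : IsConfig w) : w.length ^ 2 ≤ 2 * energy w := by
  by_cases h : w = []
  · simp [h]
  obtain ⟨m, rfl⟩ := exists_of_isConfig hw h
  have hm : m.count false + m.count true = m.length := by
    rw [add_comm]; exact List.count_true_add_count_false m
  simp only [energy, energy_append, inv, inv_append, List.length_cons, List.length_append,
    List.count_append, List.count_cons, List.count_nil, ← hm]
  simp
  set x := List.count false m
  set y := List.count true m
  zify
  nlinarith [sq_nonneg ((x : ℤ) - y), Nat.zero_le (energy m), Nat.zero_le (inv m)]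

/-- The number of `0`s at positions `≤ i` plus the number of `1`s at positions `> i`. -/
def cut (u : Word) (i : ℕ) : ℕ := (u.take (i + 1)).count false + (u.drop (i + 1)).count true

/-- The positions of the adjacent pairs `10` of the padded word. -/
def desc (w : Word) : Finset ℕ :=
  (Finset.range (w.length + 1)).filter
    (fun i => (pad w).getD i true = true ∧ (pad w).getD (i + 1) true = false)

/-- The positions of the adjacent pairs `01` of the padded word. -/
def asc (w : Word) : Finset ℕ :=
  (Finset.range (w.length + 1)).filter
    (fun i => (pad w).getD i true = false ∧ (pad w).getD (i + 1) true = true)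

lemma swapPair_append (a b : Word) (x y : Bool) :
    swapPair (a ++ x :: y :: b) a.length = a ++ y :: x :: b := by
  simp [swapPair, setPair]

lemma exists_append_of_lt (u : Word) (i : ℕ) (hi : i + 1 < u.length) :
    ∃ a b : Word, a.length = i ∧ u = a ++ u.getD i true :: u.getD (i + 1) true :: b := by
  refine ⟨u.take i, u.drop (i + 2), by simp; omega, ?_⟩
  rw [List.getD_eq_getElem _ _ hi, List.getD_eq_getElem _ _ (by omega : i < u.length),
    List.getElem_cons_drop, List.getElem_cons_drop, List.take_append_drop]

lemma length_pad (w : Word) : (pad w).length = w.length + 2 := by simp [pad]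

lemma cut_append (a b : Word) (x y : Bool) :
    cut (a ++ x :: y :: b) a.length
      = a.count false + [x].count false + ([y].count true + b.count true) := by
  have h : a ++ x :: y :: b = (a ++ [x]) ++ ([y] ++ b) := by simp
  have h2 : a.length + 1 = (a ++ [x]).length := by simp
  rw [cut, h, h2, List.take_left, List.drop_left, List.count_append, List.count_append]

lemma length_split (w a b : Word) (x y : Bool) (h : pad w = a ++ x :: y :: b) :
    a.count false + b.count true ≤ w.length := by
  have h1 := congrArg List.length h
  have h2 : a.count false ≤ a.length := List.count_le_length
  have h3 : b.count true ≤ b.length := List.count_le_length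
  simp [length_pad] at h1
  omega

lemma swap_desc {w : Word} {i : ℕ} (hi : i ∈ desc w) :
    energy (strip (swapPair (pad w) i)) = energy w + 2 * (cut (pad w) i + 1) ∧
    inv (strip (swapPair (pad w) i)) = inv w + 1 ∧ cut (pad w) i ≤ w.length := by
  simp only [desc, Finset.mem_filter, Finset.mem_range] at hi
  obtain ⟨h, h1, h2⟩ := hi
  obtain ⟨a, b, rfl, hu⟩ := exists_append_of_lt (pad w) i (by rw [length_pad]; omega)
  rw [h1, h2] at hu
  have hl := length_split w a b _ _ hu
  rw [energy_strip, inv_strip, ← energy_pad w, ← inv_pad w, hu, swapPair_append, cut_append]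
  refine ⟨?_, ?_, ?_⟩
  · simp [energy_append, energy, inv]; ring
  · simp [inv_append, inv]; ring
  · simpa using hl

lemma swap_asc {w : Word} {i : ℕ} (hi : i ∈ asc w) :
    energy w + 2 = energy (strip (swapPair (pad w) i)) + 2 * cut (pad w) i ∧
    inv w = inv (strip (swapPair (pad w) i)) + 1 ∧ cut (pad w) i ≤ w.length + 2 ∧
    2 ≤ cut (pad w) i := by
  simp only [asc, Finset.mem_filter, Finset.mem_range] at hi
  obtain ⟨h, h1, h2⟩ := hi
  obtain ⟨a, b, rfl, hu⟩ := exists_append_of_lt (pad w) i (by rw [length_pad]; omega)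
  rw [h1, h2] at hu
  have hl := length_split w a b _ _ hu
  rw [energy_strip, inv_strip, ← energy_pad w, ← inv_pad w, hu, swapPair_append, cut_append]
  refine ⟨?_, ?_, ?_, ?_⟩
  · simp [energy_append, energy, inv]; ring
  · simp [inv_append, inv]; ring
  · simp; omega
  · simp; omega

lemma sum_desc_sub_sum_asc (w : Word) (f : ℕ → ℤ) :
    ∑ i ∈ desc w, f i - ∑ i ∈ asc w, f i = ∑ i ∈ Finset.range (w.length + 1),
      (((pad w).getD i true).toInt - ((pad w).getD (i + 1) true).toInt) * f i := by
  rw [desc, asc, Finset.sum_filter, Finset.sum_filter, ← Finset.sum_sub_distrib]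
  refine Finset.sum_congr rfl fun i _ => ?_
  cases (pad w).getD i true <;> cases (pad w).getD (i + 1) true <;> simp

lemma getD_pad_zero (w : Word) : (pad w).getD 0 true = true := by simp [pad]

lemma getD_pad_last (w : Word) : (pad w).getD (w.length + 1) true = false := by simp [pad]

lemma card_desc (w : Word) : (desc w).card = (asc w).card + 1 := by
  have h := sum_desc_sub_sum_asc w (fun _ => 1)
  simp only [mul_one] at h
  rw [Finset.sum_range_sub', getD_pad_zero, getD_pad_last] at h
  simp at h
  omega

lemma count_take_succ (u : Word) (i : ℕ) (hi : i < u.length) :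
    ((u.take (i + 1)).count false : ℤ) = (u.take i).count false + (1 - (u.getD i true).toInt) := by
  rw [List.take_add_one, List.getD_eq_getElem _ _ hi, List.getElem?_eq_getElem hi]
  cases u[i] <;> simp

lemma count_drop_succ (u : Word) (i : ℕ) (hi : i < u.length) :
    ((u.drop i).count true : ℤ) = (u.drop (i + 1)).count true + (u.getD i true).toInt := by
  rw [List.drop_eq_getElem_cons hi, List.getD_eq_getElem _ _ hi]
  cases u[i] <;> simp

lemma sum_cut (w : Word) : ∑ i ∈ desc w, cut (pad w) i = ∑ i ∈ asc w, cut (pad w) i := by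
  have h := sum_desc_sub_sum_asc w (fun i => cut (pad w) i)
  have key : ∀ i ∈ Finset.range (w.length + 1),
      (((pad w).getD i true).toInt - ((pad w).getD (i + 1) true).toInt) * (cut (pad w) i : ℤ)
      = (((pad w).getD i true).toInt * cut (pad w) i - ((pad w).drop (i + 1)).count true)
        - (((pad w).getD (i + 1) true).toInt * cut (pad w) (i + 1)
          - ((pad w).drop (i + 1 + 1)).count true) := by
    intro i hi
    have hi' : i + 1 < (pad w).length := by
      rw [length_pad]; have := Finset.mem_range.1 hi; omega
    have h1 := count_take_succ _ _ hi'
    have h2 := count_drop_succ _ _ hi'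
    simp only [cut]
    push_cast
    rw [h1, h2]
    cases (pad w).getD (i + 1) true <;> (simp; try ring)
  rw [Finset.sum_congr rfl key, Finset.sum_range_sub', getD_pad_zero, getD_pad_last] at h
  have h3 : (pad w).drop (w.length + 1 + 1) = [] := by
    apply List.drop_eq_nil_of_le; rw [length_pad]
  have h4 : cut (pad w) 0 = ((pad w).drop (0 + 1)).count true := by simp [cut, pad]
  rw [h3, h4] at h
  simp at h
  zify
  linarith

lemma card_asc_le_cut (w : Word) (i : ℕ) (hi : i < w.length + 1) :
    (asc w).card ≤ cut (pad w) i := by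
  have h1 : ∀ j ≤ w.length + 1, ((asc w).filter (· < j)).card ≤ ((pad w).take j).count false := by
    intro j
    induction j with
    | zero => simp
    | succ j ih =>
      intro hj
      have hj' : j < (pad w).length := by rw [length_pad]; omega
      have h2 := count_take_succ _ _ hj'
      have h3 := ih (by omega)
      by_cases hm : j ∈ asc w
      · have h4 : (asc w).filter (· < j + 1) ⊆ insert j ((asc w).filter (· < j)) := by
          intro x; simp only [Finset.mem_filter, Finset.mem_insert]; intro hx
          by_cases hxj : x = j
          · exact Or.inl hxj
          · exact Or.inr ⟨hx.1, by omega⟩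
        have h5 := (Finset.card_le_card h4).trans (Finset.card_insert_le _ _)
        simp only [asc, Finset.mem_filter] at hm
        rw [hm.2.1] at h2
        simp at h2
        omega
      · have h4 : (asc w).filter (· < j + 1) ⊆ (asc w).filter (· < j) := by
          intro x; simp only [Finset.mem_filter]; intro hx
          have : x ≠ j := fun h => hm (h ▸ hx.1)
          exact ⟨hx.1, by omega⟩
        have h5 := Finset.card_le_card h4
        have h6 : ((pad w).getD j true).toInt ≤ 1 := by cases (pad w).getD j true <;> simp
        omega
  have h2 : ∀ k j, j + k = w.length + 1 →
      ((asc w).filter (j ≤ ·)).card ≤ ((pad w).drop (j + 1)).count true := by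
    intro k
    induction k with
    | zero =>
      intro j hj
      have : (asc w).filter (j ≤ ·) = ∅ := by
        apply Finset.filter_eq_empty_iff.2
        intro x hx
        simp only [asc, Finset.mem_filter, Finset.mem_range] at hx
        omega
      simp [this]
    | succ k ih =>
      intro j hj
      have hj' : j + 1 < (pad w).length := by rw [length_pad]; omega
      have h2 := count_drop_succ _ _ hj'
      have h3 := ih (j + 1) (by omega)
      by_cases hm : j ∈ asc w
      · have h4 : (asc w).filter (j ≤ ·) ⊆ insert j ((asc w).filter (j + 1 ≤ ·)) := by
          intro x; simp only [Finset.mem_filter, Finset.mem_insert]; intro hx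
          by_cases hxj : x = j
          · exact Or.inl hxj
          · exact Or.inr ⟨hx.1, by omega⟩
        have h5 := (Finset.card_le_card h4).trans (Finset.card_insert_le _ _)
        simp only [asc, Finset.mem_filter] at hm
        rw [hm.2.2] at h2
        simp at h2
        omega
      · have h4 : (asc w).filter (j ≤ ·) ⊆ (asc w).filter (j + 1 ≤ ·) := by
          intro x; simp only [Finset.mem_filter]; intro hx
          have : x ≠ j := fun h => hm (h ▸ hx.1)
          exact ⟨hx.1, by omega⟩
        have h5 := Finset.card_le_card h4
        have h6 : 0 ≤ ((pad w).getD (j + 1) true).toInt := by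
          cases (pad w).getD (j + 1) true <;> simp
        omega
  have h3 := h1 i (by omega)
  have h4 := h2 (w.length + 1 - i) i (by omega)
  have h5 : (asc w).card = ((asc w).filter (· < i)).card + ((asc w).filter (i ≤ ·)).card := by
    rw [← Finset.card_filter_add_card_filter_not (s := asc w) (· < i)]
    simp
  have h6 : ((pad w).take i).count false ≤ ((pad w).take (i + 1)).count false :=
    (List.take_sublist_take_left (by omega)).count_le _
  rw [cut]
  omega

lemma sq_card_desc_le (w : Word) :
    (desc w).card ^ 2 ≤ ∑ i ∈ desc w, (cut (pad w) i + 1) := by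
  rw [sq, ← smul_eq_mul]
  refine Finset.card_nsmul_le_sum _ _ _ fun i hi => ?_
  rw [card_desc]
  simp only [desc, Finset.mem_filter, Finset.mem_range] at hi
  have := card_asc_le_cut w i hi.1
  omega

lemma endpoints_mem_desc {w : Word} (hw : IsConfig w) (h : w ≠ []) :
    0 ∈ desc w ∧ w.length ∈ desc w ∧ cut (pad w) 0 + cut (pad w) w.length = w.length := by
  obtain ⟨m, rfl⟩ := exists_of_isConfig hw h
  refine ⟨by simp [desc, pad], ?_, ?_⟩
  · simp only [desc, Finset.mem_filter, Finset.mem_range]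
    refine ⟨by omega, ?_, getD_pad_last _⟩
    simp [pad]
  · have h1 : (pad (false :: (m ++ [true]))).take ((false :: (m ++ [true])).length + 1)
        = true :: false :: (m ++ [true]) :=
      List.take_left' (l₁ := true :: false :: (m ++ [true])) (l₂ := [false]) (by simp)
    have h2 : (pad (false :: (m ++ [true]))).drop ((false :: (m ++ [true])).length + 1)
        = [false] :=
      List.drop_left' (l₁ := true :: false :: (m ++ [true])) (l₂ := [false]) (by simp)
    rw [cut, cut, h1, h2]
    have hm : m.count false + m.count true = m.length := by
      rw [add_comm]; exact List.count_true_add_count_false m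
    simp [pad]
    omega

lemma length_le_sum_cut {w : Word} (hw : IsConfig w) (h : w ≠ []) :
    w.length ≤ ∑ i ∈ desc w, (cut (pad w) i + 1) ∧ 2 ≤ (desc w).card := by
  obtain ⟨h0, hL, hc⟩ := endpoints_mem_desc hw h
  have hne : (0 : ℕ) ≠ w.length := fun h' => h (List.length_eq_zero_iff.1 h'.symm)
  have hsub : ({0, w.length} : Finset ℕ) ⊆ desc w := by
    intro x hx
    rcases Finset.mem_insert.1 hx with rfl | hx
    · exact h0
    · rw [Finset.mem_singleton.1 hx]; exact hL
  constructor
  · have h1 := Finset.sum_le_sum_of_subset (f := fun i => cut (pad w) i + 1) hsub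
    rw [Finset.sum_pair hne] at h1
    omega
  · have h1 := Finset.card_le_card hsub
    rwa [Finset.card_pair hne] at h1

/-- The configuration obtained by swapping the `i`-th adjacent pair of the padded word. -/
def nbr (w : Word) (i : ℕ) : Word := strip (swapPair (pad w) i)

/-- The one-step expectation of `f` for the pure exclusion chain at `w`. -/
noncomputable def mean (p : ℝ) (f : Word → ℝ) (w : Word) : ℝ :=
  ∑ i ∈ desc w, ((desc w).card + (asc w).card : ℝ)⁻¹ * ((1 - p) * f (nbr w i) + p * f w)
  + ∑ i ∈ asc w, ((desc w).card + (asc w).card : ℝ)⁻¹ * (p * f (nbr w i) + (1 - p) * f w)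

lemma sum_unlike {M : Type*} [AddCommMonoid M] (w : Word) (f : ℕ → M) :
    ((unlike w).map f).sum = ∑ i ∈ desc w, f i + ∑ i ∈ asc w, f i := by
  have h : (unlike w).Nodup := List.Nodup.filter _ List.nodup_range
  rw [← List.sum_toFinset _ h, unlike, List.toFinset_filter, List.toFinset_range, desc, asc,
    Finset.sum_filter, Finset.sum_filter, Finset.sum_filter, ← Finset.sum_add_distrib]
  refine Finset.sum_congr rfl fun i _ => ?_
  cases (pad w).getD i true <;> cases (pad w).getD (i + 1) true <;> simp

lemma length_unlike (w : Word) : (unlike w).length = (desc w).card + (asc w).card := by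
  have h := sum_unlike w (fun _ => 1)
  rw [List.map_const', List.sum_replicate] at h
  simpa using h

lemma P_eq_mean (p : ℝ) (w w' : Word) :
    P 0 p w w' = mean p (fun v => if v = w' then 1 else 0) w := by
  rw [P, sum_unlike, length_unlike, mean]
  push_cast
  congr 1
  · refine Finset.sum_congr rfl fun i hi => ?_
    simp only [desc, Finset.mem_filter] at hi
    have e : (if nbr w i = w' then (1 : ℝ) else 0)
        = if strip (swapPair (pad w) i) = w' then 1 else 0 := rfl
    simp only [hi.2.1, if_true]
    rw [e]
    ring
  · refine Finset.sum_congr rfl fun i hi => ?_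
    simp only [asc, Finset.mem_filter] at hi
    have e : (if nbr w i = w' then (1 : ℝ) else 0)
        = if strip (swapPair (pad w) i) = w' then 1 else 0 := rfl
    simp only [hi.2.1, Bool.false_eq_true, if_false]
    rw [e]
    ring

lemma mean_nonneg {p : ℝ} (hp0 : 0 ≤ p) (hp1 : p ≤ 1) {f : Word → ℝ} (hf : ∀ v, 0 ≤ f v)
    (w : Word) : 0 ≤ mean p f w := by
  have h1 : 0 ≤ 1 - p := sub_nonneg.2 hp1
  exact add_nonneg
    (Finset.sum_nonneg fun i _ => mul_nonneg (by positivity)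
      (add_nonneg (mul_nonneg h1 (hf _)) (mul_nonneg hp0 (hf _))))
    (Finset.sum_nonneg fun i _ => mul_nonneg (by positivity)
      (add_nonneg (mul_nonneg hp0 (hf _)) (mul_nonneg h1 (hf _))))

lemma mean_congr {p : ℝ} {f g : Word → ℝ} {w : Word} (hw : f w = g w)
    (h : ∀ i ∈ desc w ∪ asc w, f (nbr w i) = g (nbr w i)) : mean p f w = mean p g w := by
  unfold mean
  rw [hw]
  congr 1
  · exact Finset.sum_congr rfl fun i hi => by rw [h i (Finset.mem_union_left _ hi)]
  · exact Finset.sum_congr rfl fun i hi => by rw [h i (Finset.mem_union_right _ hi)]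

lemma mean_add (p : ℝ) (f g : Word → ℝ) (w : Word) :
    mean p (fun v => f v + g v) w = mean p f w + mean p g w := by
  simp only [mean, mul_add, Finset.sum_add_distrib]
  ring

lemma mean_const_mul (p c : ℝ) (f : Word → ℝ) (w : Word) :
    mean p (fun v => c * f v) w = c * mean p f w := by
  simp only [mean, mul_add c, Finset.mul_sum]
  congr 1 <;> exact Finset.sum_congr rfl fun i _ => by ring

lemma mean_sum (p : ℝ) {ι : Type*} (s : Finset ι) (f : ι → Word → ℝ) (w : Word) :
    mean p (fun v => ∑ j ∈ s, f j v) w = ∑ j ∈ s, mean p (f j) w := by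
  classical
  induction s using Finset.induction_on with
  | empty => simp [mean]
  | insert a s ha ih => simp only [Finset.sum_insert ha, mean_add, ih]

lemma tsum_P_mul {p : ℝ} (hp0 : 0 ≤ p) (hp1 : p ≤ 1) {f : Word → ℝ} (hf : ∀ v, 0 ≤ f v)
    (w : Word) :
    ∑' w', ENNReal.ofReal (P 0 p w w') * ENNReal.ofReal (f w') = ENNReal.ofReal (mean p f w) := by
  classical
  have hP : ∀ w', 0 ≤ P 0 p w w' := fun w' => by
    rw [P_eq_mean]
    exact mean_nonneg hp0 hp1 (fun v => by split_ifs <;> norm_num) w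
  set S : Finset Word := insert w ((desc w ∪ asc w).image (nbr w)) with hS
  have hwS : w ∈ S := Finset.mem_insert_self _ _
  have hnS : ∀ i ∈ desc w ∪ asc w, nbr w i ∈ S := fun i hi =>
    Finset.mem_insert_of_mem (Finset.mem_image_of_mem _ hi)
  rw [tsum_eq_sum (s := S)]
  · rw [Finset.sum_congr rfl fun w' _ => (ENNReal.ofReal_mul (hP w')).symm,
      ← ENNReal.ofReal_sum_of_nonneg fun w' _ => mul_nonneg (hP w') (hf w')]
    congr 1
    have h1 : ∀ w' ∈ S, P 0 p w w' * f w'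
        = mean p (fun v => f w' * if v = w' then 1 else 0) w := fun w' _ => by
      rw [mean_const_mul, P_eq_mean, mul_comm]
    rw [Finset.sum_congr rfl h1, ← mean_sum]
    refine mean_congr ?_ fun i hi => ?_
    · simp [hwS]
    · simp [hnS i hi]
  · intro w' hw'
    have h1 : P 0 p w w' = 0 := by
      rw [P_eq_mean, mean_congr (g := fun _ => 0)]
      · simp [mean]
      · exact if_neg fun h : w = w' => hw' (h ▸ hwS)
      · exact fun i hi => if_neg fun h : nbr w i = w' => hw' (h ▸ hnS i hi)
    simp [h1]

lemma card_pos (w : Word) : (0 : ℝ) < (desc w).card + (asc w).card := by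
  rw [card_desc]; push_cast; positivity

lemma mul_mean_sub (p : ℝ) (f : Word → ℝ) (w : Word) :
    ((desc w).card + (asc w).card : ℝ) * (mean p f w - f w)
      = (1 - p) * ∑ i ∈ desc w, (f (nbr w i) - f w) + p * ∑ i ∈ asc w, (f (nbr w i) - f w) := by
  have h := card_pos w
  simp only [mean, ← Finset.mul_sum, Finset.sum_add_distrib, Finset.sum_sub_distrib,
    Finset.sum_const, nsmul_eq_mul]
  field_simp
  ring

lemma one_add_pow_le (k : ℕ) {t : ℝ} (h1 : -1 ≤ t) (h2 : t ≤ 1) :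
    (1 + t) ^ k ≤ 1 + k * t + 4 ^ k * t ^ 2 := by
  induction k with
  | zero => simp; positivity
  | succ k ih =>
    have h3 : (k : ℝ) ≤ 4 ^ k := by exact_mod_cast (Nat.lt_pow_self (by norm_num : 1 < 4)).le
    calc (1 + t) ^ (k + 1) = (1 + t) ^ k * (1 + t) := pow_succ _ _
      _ ≤ (1 + k * t + 4 ^ k * t ^ 2) * (1 + t) :=
          mul_le_mul_of_nonneg_right ih (by linarith)
      _ = 1 + (k + 1) * t + (k + 4 ^ k * (1 + t)) * t ^ 2 := by ring
      _ ≤ 1 + (k + 1) * t + 4 ^ (k + 1) * t ^ 2 := by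
          gcongr
          rw [pow_succ]
          nlinarith [pow_pos (by norm_num : (0 : ℝ) < 4) k]
      _ = _ := by push_cast; ring

lemma mul_add_pow_sub_le (k : ℕ) {x d : ℝ} (hx : 0 < x) (hd : |d| ≤ x) :
    x * ((x + d) ^ (k + 1) - x ^ (k + 1)) ≤ (k + 1) * x ^ (k + 1) * d + 4 ^ (k + 1) * x ^ k * d ^ 2
    := by
  obtain ⟨t, rfl⟩ : ∃ t, d = x * t := ⟨d / x, by field_simp⟩
  rw [abs_mul, abs_of_pos hx] at hd
  have ht := abs_le.1 (le_of_mul_le_mul_left (hd.trans_eq (mul_one x).symm) hx)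
  have h := one_add_pow_le (k + 1) ht.1 ht.2
  have h2 : x + x * t = x * (1 + t) := by ring
  rw [h2, mul_pow]
  have h3 := mul_le_mul_of_nonneg_left h (pow_pos hx (k + 2)).le
  push_cast at h3
  calc x * (x ^ (k + 1) * (1 + t) ^ (k + 1) - x ^ (k + 1))
      = x ^ (k + 2) * (1 + t) ^ (k + 1) - x ^ (k + 2) := by ring
    _ ≤ x ^ (k + 2) * (1 + (k + 1) * t + 4 ^ (k + 1) * t ^ 2) - x ^ (k + 2) := by linarith
    _ = _ := by ring

/-- The total size `∑ (cut + 1)` of the energy increments at the pairs `10`. -/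
noncomputable def flux (w : Word) : ℝ := ∑ i ∈ desc w, ((cut (pad w) i : ℝ) + 1)

lemma energy_nbr_desc {w : Word} {i : ℕ} (hi : i ∈ desc w) :
    (energy (nbr w i) : ℝ) = energy w + 2 * (cut (pad w) i + 1) := by
  exact_mod_cast (swap_desc hi).1

lemma energy_nbr_asc {w : Word} {i : ℕ} (hi : i ∈ asc w) :
    (energy (nbr w i) : ℝ) = energy w + (2 - 2 * cut (pad w) i) := by
  have h : (energy w : ℝ) + 2 = energy (nbr w i) + 2 * cut (pad w) i := by
    exact_mod_cast (swap_asc hi).1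
  linarith

lemma sum_asc_cut (w : Word) :
    ∑ i ∈ asc w, (2 - 2 * (cut (pad w) i : ℝ))
      = 2 * ((desc w).card + (asc w).card : ℝ) - 2 * flux w := by
  have h : ∑ i ∈ desc w, (cut (pad w) i : ℝ) = ∑ i ∈ asc w, (cut (pad w) i : ℝ) := by
    exact_mod_cast sum_cut w
  rw [flux, Finset.sum_sub_distrib, Finset.sum_add_distrib, ← Finset.mul_sum, ← h]
  simp
  ring

lemma mul_mean_energy_pow_le {p : ℝ} (hp0 : 0 ≤ p) (hp1 : p ≤ 1) (k : ℕ) {w : Word}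
    (hpos : 0 < energy w) (hw : 2 * (w.length + 1) ≤ energy w) :
    ((desc w).card + (asc w).card : ℝ) * energy w *
        (mean p (fun v => (energy v : ℝ) ^ (k + 1)) w - (energy w : ℝ) ^ (k + 1))
      ≤ (energy w : ℝ) ^ k * ((k + 1) * energy w *
          (2 * p * ((desc w).card + (asc w).card) - 2 * (2 * p - 1) * flux w)
          + 8 * 4 ^ (k + 1) * (w.length + 1) * flux w) := by
  have hx0 : (0 : ℝ) < (energy w : ℝ) := by exact_mod_cast hpos
  have hxL : 2 * ((w.length : ℝ) + 1) ≤ (energy w : ℝ) := by exact_mod_cast hw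
  set x : ℝ := (energy w : ℝ) with hx
  set n : ℝ := (desc w).card + (asc w).card with hn
  have hn0 : 0 < n := card_pos w
  have hK : (0 : ℝ) ≤ 4 ^ (k + 1) * x ^ k := by positivity
  have hd : ∀ i ∈ desc w, x * ((energy (nbr w i) : ℝ) ^ (k + 1) - x ^ (k + 1))
      ≤ (k + 1) * x ^ (k + 1) * (2 * (cut (pad w) i + 1))
        + 4 ^ (k + 1) * x ^ k * (2 * (w.length + 1) * (2 * (cut (pad w) i + 1))) := by
    intro i hi
    have hc : (cut (pad w) i : ℝ) ≤ w.length := by exact_mod_cast (swap_desc hi).2.2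
    have hc0 : (0 : ℝ) ≤ cut (pad w) i := by positivity
    rw [energy_nbr_desc hi]
    refine (mul_add_pow_sub_le k hx0 ?_).trans ?_
    · rw [abs_of_nonneg (by positivity)]; linarith
    · refine add_le_add le_rfl (mul_le_mul_of_nonneg_left ?_ hK)
      nlinarith
  have ha : ∀ i ∈ asc w, x * ((energy (nbr w i) : ℝ) ^ (k + 1) - x ^ (k + 1))
      ≤ (k + 1) * x ^ (k + 1) * (2 - 2 * cut (pad w) i)
        + 4 ^ (k + 1) * x ^ k * (2 * (w.length + 1) * (-(2 - 2 * cut (pad w) i))) := by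
    intro i hi
    have hc : (cut (pad w) i : ℝ) ≤ w.length + 2 := by exact_mod_cast (swap_asc hi).2.2.1
    have hc0 : (2 : ℝ) ≤ cut (pad w) i := by exact_mod_cast (swap_asc hi).2.2.2
    rw [energy_nbr_asc hi]
    refine (mul_add_pow_sub_le k hx0 ?_).trans ?_
    · rw [abs_of_nonpos (by linarith)]; linarith
    · refine add_le_add le_rfl (mul_le_mul_of_nonneg_left ?_ hK)
      nlinarith
  have hsd := Finset.sum_le_sum hd
  have hsa := Finset.sum_le_sum ha
  rw [← Finset.mul_sum, Finset.sum_add_distrib, ← Finset.mul_sum, ← Finset.mul_sum,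
    ← Finset.mul_sum, ← Finset.mul_sum, ← Finset.mul_sum, ← flux] at hsd
  rw [← Finset.mul_sum, Finset.sum_add_distrib, ← Finset.mul_sum, ← Finset.mul_sum,
    ← Finset.mul_sum, Finset.sum_neg_distrib, sum_asc_cut] at hsa
  have hQ : n ≤ flux w := by
    have h := Finset.sum_nonneg (s := asc w) (f := fun i => -(2 - 2 * (cut (pad w) i : ℝ)))
      fun i hi => by
        have hc0 : (2 : ℝ) ≤ cut (pad w) i := by exact_mod_cast (swap_asc hi).2.2.2
        linarith
    rw [Finset.sum_neg_distrib, sum_asc_cut] at h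
    linarith
  have hm := mul_mean_sub p (fun v => (energy v : ℝ) ^ (k + 1)) w
  rw [← hn, ← hx] at hm
  have h1 := mul_le_mul_of_nonneg_left hsd (sub_nonneg.2 hp1)
  have h2 := mul_le_mul_of_nonneg_left hsa hp0
  have h3 : (1 - p) * (2 * flux w) + p * (-(2 * n - 2 * flux w)) ≤ 4 * flux w := by nlinarith
  have h4 := mul_le_mul_of_nonneg_left h3
    (mul_nonneg hK (by positivity : (0 : ℝ) ≤ 2 * (w.length + 1)))
  calc n * x * (mean p (fun v => (energy v : ℝ) ^ (k + 1)) w - x ^ (k + 1))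
      = x * (n * (mean p (fun v => (energy v : ℝ) ^ (k + 1)) w - x ^ (k + 1))) := by ring
    _ = _ := by rw [hm]
    _ ≤ _ := by linear_combination h1 + h2 + h4

lemma mean_energy_pow_le {p : ℝ} (hp : 1 / 2 < p) (hp1 : p ≤ 1) (k : ℕ) :
    ∃ L₀ : ℕ, ∀ w : Word, IsConfig w → L₀ ≤ w.length →
      1 ≤ energy w ∧
      mean p (fun v => (energy v : ℝ) ^ (k + 1)) w + (energy w : ℝ) ^ k
        ≤ (energy w : ℝ) ^ (k + 1) := by
  have hγ : 0 < 2 * p - 1 := by linarith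
  set γ := 2 * p - 1 with hγ'
  obtain ⟨L₁, hL₁⟩ := exists_nat_ge (32 * 4 ^ (k + 1) / γ)
  obtain ⟨L₂, hL₂⟩ := exists_nat_ge (36 / γ ^ 2)
  refine ⟨6 + L₁ + L₂, fun w hw hL => ?_⟩
  have hne : w ≠ [] := by rintro rfl; simp at hL
  have hsq := sq_length_le_energy hw
  have h6 : 6 ≤ w.length := by omega
  have hxN : 2 * (w.length + 1) ≤ energy w := by nlinarith
  have hpos : 0 < energy w := by omega
  refine ⟨hpos, ?_⟩
  have key := mul_mean_energy_pow_le (by linarith) hp1 k hpos hxN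
  have hsqR : (w.length : ℝ) ^ 2 ≤ 2 * energy w := by exact_mod_cast hsq
  have h6R : (6 : ℝ) ≤ w.length := by exact_mod_cast h6
  have hL1 : 32 * 4 ^ (k + 1) ≤ γ * w.length := by
    rw [div_le_iff₀ hγ] at hL₁
    have : (L₁ : ℝ) ≤ w.length := by exact_mod_cast (by omega : L₁ ≤ w.length)
    nlinarith
  have hL2 : 36 ≤ γ ^ 2 * w.length := by
    rw [div_le_iff₀ (by positivity)] at hL₂
    have : (L₂ : ℝ) ≤ w.length := by exact_mod_cast (by omega : L₂ ≤ w.length)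
    nlinarith [sq_nonneg γ]
  have hQ1 : (w.length : ℝ) ≤ flux w := by
    rw [flux]; exact_mod_cast (length_le_sum_cut hw hne).1
  have hQ2 : ((desc w).card : ℝ) ^ 2 ≤ flux w := by
    rw [flux]; exact_mod_cast sq_card_desc_le w
  have hcard : ((desc w).card : ℝ) = (asc w).card + 1 := by exact_mod_cast card_desc w
  have hn0 := card_pos w
  have hx0 : (0 : ℝ) < (energy w : ℝ) := by exact_mod_cast hpos
  set n : ℝ := (desc w).card + (asc w).card with hn
  set x : ℝ := (energy w : ℝ) with hx
  set Q := flux w with hQ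
  set L : ℝ := (w.length : ℝ) with hLdef
  have hQ0 : 0 < Q := by linarith
  have hc1 : (1 : ℝ) ≤ (desc w).card := by
    rw [hcard]; linarith [(Nat.cast_nonneg (asc w).card : (0 : ℝ) ≤ _)]
  have hn2 : n ^ 2 ≤ 4 * Q := by
    have : n ^ 2 ≤ (2 * (desc w).card) ^ 2 := pow_le_pow_left₀ hn0.le (by linarith) 2
    linarith
  have hQn : 3 * n ≤ γ * Q := by
    have h1 : L * n ^ 2 ≤ Q * (4 * Q) := mul_le_mul hQ1 hn2 (sq_nonneg n) hQ0.le
    have h2 := mul_le_mul_of_nonneg_right hL2 (sq_nonneg n)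
    have h3 := mul_le_mul_of_nonneg_left h1 (sq_nonneg γ)
    refine (sq_le_sq₀ (by linarith) (mul_pos hγ hQ0).le).1 ?_
    linear_combination (h2 + h3) / 4
  have hKx : 8 * 4 ^ (k + 1) * (L + 1) ≤ γ * x := by
    have h1 := mul_le_mul_of_nonneg_right hL1 (by linarith : 0 ≤ L)
    have h2 : (0 : ℝ) ≤ 4 ^ (k + 1) * (L - 1) := mul_nonneg (by positivity) (by linarith)
    have h3 := mul_le_mul_of_nonneg_left hsqR hγ.le
    linear_combination h1 / 2 + 8 * h2 + h3 / 2
  have hk : (0 : ℝ) ≤ k := by positivity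
  have h1 : (k + 1) * x * (2 * p * n - 2 * γ * Q) + 8 * 4 ^ (k + 1) * (L + 1) * Q ≤ -(x * n) := by
    have h2 := mul_le_mul_of_nonneg_right hKx hQ0.le
    have h3 : 2 * p * n - γ * Q ≤ -n := by
      have := mul_le_mul_of_nonneg_right hp1 hn0.le
      linarith
    have h4 := mul_le_mul_of_nonneg_left h3 (by positivity : 0 ≤ (k + 1) * x)
    have h5 : 0 ≤ k * (x * n) := by positivity
    have h6 : 0 ≤ k * (x * (γ * Q)) := by positivity
    linear_combination h2 + h4 + h5 + h6
  have h2 := key.trans (mul_le_mul_of_nonneg_left h1 (pow_pos hx0 k).le)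
  have h3 : n * x * (mean p (fun v => (energy v : ℝ) ^ (k + 1)) w - x ^ (k + 1))
      ≤ n * x * (-x ^ k) := h2.trans_eq (by ring)
  have h4 := le_of_mul_le_mul_left h3 (by positivity)
  linarith

/-- A bounded function of the configuration with strictly negative drift off the ground state. -/
noncomputable def bdd (w : Word) : ℝ := 1 - (1 / 2) ^ inv w

lemma bdd_nonneg (w : Word) : 0 ≤ bdd w :=
  sub_nonneg.2 (pow_le_one₀ (by norm_num) (by norm_num))

lemma bdd_le_one (w : Word) : bdd w ≤ 1 := sub_le_self _ (by positivity)

lemma mean_bdd_lt {p : ℝ} (hp : 1 / 2 < p) {w : Word} (hw : IsConfig w)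
    (hne : w ≠ []) : mean p bdd w < bdd w := by
  have h := mul_mean_sub p bdd w
  have hn := card_pos w
  have hd : ∀ i ∈ desc w, bdd (nbr w i) - bdd w = (1 / 2) ^ inv w / 2 := fun i hi => by
    rw [bdd, bdd, nbr, (swap_desc hi).2.1]; ring
  have ha : ∀ i ∈ asc w, bdd (nbr w i) - bdd w = -(1 / 2) ^ inv w := fun i hi => by
    rw [bdd, bdd, nbr, (swap_asc hi).2.1]; ring
  rw [Finset.sum_congr rfl hd, Finset.sum_congr rfl ha] at h
  simp only [Finset.sum_const, nsmul_eq_mul] at h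
  have hcard : ((desc w).card : ℝ) = (asc w).card + 1 := by exact_mod_cast card_desc w
  have h2 : (1 : ℝ) ≤ (asc w).card := by
    have h3 := (length_le_sum_cut hw hne).2
    rw [card_desc] at h3
    exact_mod_cast (by omega : 1 ≤ (asc w).card)
  have h3 : (0 : ℝ) < (1 / 2) ^ inv w := by positivity
  have h4 : (1 - p) * ((asc w).card + 1) / 2 - p * (asc w).card < 0 := by nlinarith
  have h5 := mul_neg_of_neg_of_pos h4 h3
  have h6 : ((desc w).card + (asc w).card : ℝ) * (mean p bdd w - bdd w) < 0 := by
    rw [h, hcard]; linarith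
  have := (pos_iff_neg_of_mul_neg h6).1 hn
  linarith

/-- The polynomial weights appearing in the drift conditions. -/
noncomputable def weight (k : ℕ) (w : Word) : ℝ := (1 + energy w) ^ k

lemma one_le_weight (k : ℕ) (w : Word) : 1 ≤ weight k w :=
  one_le_pow₀ (by linarith [(Nat.cast_nonneg (energy w) : (0 : ℝ) ≤ _)])

lemma exists_lyapunov {p : ℝ} (hp : 1 / 2 < p) (hp1 : p ≤ 1) (k : ℕ) :
    ∃ (U : Word → ℝ) (C : ℝ), 0 ≤ C ∧ (∀ w, 0 ≤ U w) ∧ (∀ w, U w ≤ C * weight (k + 1) w) ∧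
      ∀ w, IsConfig w → w ≠ [] → mean p U w + weight k w ≤ U w := by
  obtain ⟨L₀, hL₀⟩ := mean_energy_pow_le hp hp1 k
  set F : Set Word := {w | w.length < L₀} with hF
  have hfin : F.Finite := List.finite_length_lt Bool L₀
  set D : Word → ℝ := fun w =>
    2 ^ k * (mean p (fun v => (energy v : ℝ) ^ (k + 1)) w - (energy w : ℝ) ^ (k + 1))
      + weight k w with hD
  obtain ⟨A₀, hA₀⟩ := (hfin.image fun w => D w / (bdd w - mean p bdd w)).bddAbove
  set A := max A₀ 0 with hA
  have hA0 : 0 ≤ A := le_max_right _ _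
  refine ⟨fun w => 2 ^ k * (energy w : ℝ) ^ (k + 1) + A * bdd w, 2 ^ k + A, by positivity,
    fun w => add_nonneg (by positivity) (mul_nonneg hA0 (bdd_nonneg w)), fun w => ?_,
    fun w hw hne => ?_⟩
  · rw [add_mul]
    have h1 : (energy w : ℝ) ^ (k + 1) ≤ weight (k + 1) w :=
      pow_le_pow_left₀ (by positivity) (by linarith) _
    have h2 : bdd w ≤ weight (k + 1) w := (bdd_le_one w).trans (one_le_weight _ w)
    exact add_le_add (mul_le_mul_of_nonneg_left h1 (by positivity))
      (mul_le_mul_of_nonneg_left h2 hA0)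
  · rw [mean_add, mean_const_mul, mean_const_mul]
    have hb := mean_bdd_lt hp hw hne
    by_cases hwF : w ∈ F
    · have h1 := (hA₀ (Set.mem_image_of_mem _ hwF)).trans (le_max_left A₀ 0)
      rw [div_le_iff₀ (sub_pos.2 hb)] at h1
      simp only [hD] at h1
      linarith
    · obtain ⟨h1, h2⟩ := hL₀ w hw (not_lt.1 hwF)
      have h3 : (1 : ℝ) ≤ energy w := by exact_mod_cast h1
      have h4 : weight k w ≤ 2 ^ k * (energy w : ℝ) ^ k := by
        rw [weight, ← mul_pow]
        exact pow_le_pow_left₀ (by positivity) (by linarith) _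
      have h5 := mul_le_mul_of_nonneg_left h2 (by positivity : (0 : ℝ) ≤ 2 ^ k)
      have h6 := mul_le_mul_of_nonneg_left hb.le hA0
      linarith

/-- The trajectory up to and including time `t`. -/
def past {Ω : Type*} (ξ : ℕ → Ω → Word) (t : ℕ) (ω : Ω) : Fin (t + 1) → Word := fun i => ξ i ω

/-- The event that the ground state is not visited at the times `1, …, t`. -/
def alive {Ω : Type*} (ξ : ℕ → Ω → Word) (t : ℕ) : Set Ω :=
  {ω | ∀ i, 0 < i → i ≤ t → ξ i ω ≠ groundState}

lemma alive_anti {Ω : Type*} (ξ : ℕ → Ω → Word) : Antitone (alive ξ) :=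
  fun _ _ hst _ hω i hi hit => hω i hi (hit.trans hst)

section Chain

variable {Ω : Type*} [MeasurableSpace Ω] {μ : Measure Ω} {ξ : ℕ → Ω → Word} {p : ℝ}

instance : DiscreteMeasurableSpace Word := ⟨fun _ => trivial⟩

lemma measurable_ofReal_comp (hξ : ∀ t, Measurable (ξ t)) (f : Word → ℝ) (t : ℕ) :
    Measurable fun ω => ENNReal.ofReal (f (ξ t ω)) :=
  ((Measurable.of_discrete (f := f)).comp (hξ t)).ennreal_ofReal

lemma lintegral_past (hξ : ∀ t, Measurable (ξ t)) (t : ℕ) (G : (Fin (t + 1) → Word) → ℝ≥0∞) :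
    ∫⁻ ω, G (past ξ t ω) ∂μ = ∑' u, G u * μ {ω | past ξ t ω = u} := by
  have hm : Measurable (past ξ t) := measurable_pi_lambda _ fun i => hξ i
  rw [← lintegral_map (Measurable.of_discrete) hm, lintegral_countable']
  refine tsum_congr fun u => ?_
  rw [Measure.map_apply hm (MeasurableSet.of_discrete)]
  rfl

lemma measure_past_snoc (h : IsEVChain 0 p μ ξ) (t : ℕ) (u : Fin (t + 1) → Word) (w : Word) :
    μ {ω | past ξ (t + 1) ω = Fin.snoc (α := fun _ => Word) u w}
      = μ {ω | past ξ t ω = u} * ENNReal.ofReal (P 0 p (u (Fin.last t)) w) := by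
  have h2 := h.2 t fun i => if hi : i < t + 1 then u ⟨i, hi⟩ else w
  have e1 : {ω | past ξ (t + 1) ω = Fin.snoc (α := fun _ => Word) u w}
      = {ω | ∀ i ≤ t + 1, ξ i ω = if hi : i < t + 1 then u ⟨i, hi⟩ else w} := by
    ext ω
    constructor
    · intro hω i hi
      exact congrFun hω ⟨i, by omega⟩
    · intro hω
      ext1 i
      exact hω i (by omega)
  have e2 : {ω | past ξ t ω = u}
      = {ω | ∀ i ≤ t, ξ i ω = if hi : i < t + 1 then u ⟨i, hi⟩ else w} := by
    ext ω
    constructor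
    · intro hω i hi
      rw [dif_pos (by omega)]
      exact congrFun hω ⟨i, by omega⟩
    · intro hω
      ext1 i
      have := hω i (by omega)
      rwa [dif_pos (by omega)] at this
  rw [e1, e2, h2]
  simp [Fin.last]

lemma lintegral_past_mul (h : IsEVChain 0 p μ ξ) (t : ℕ) (B : (Fin (t + 1) → Word) → ℝ≥0∞)
    (F : Word → ℝ≥0∞) :
    ∫⁻ ω, B (past ξ t ω) * F (ξ (t + 1) ω) ∂μ
      = ∫⁻ ω, B (past ξ t ω) * ∑' w, ENNReal.ofReal (P 0 p (ξ t ω) w) * F w ∂μ := by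
  have e1 := lintegral_past (μ := μ) h.1 (t + 1)
    fun u => B (Fin.init u) * F (u (Fin.last (t + 1)))
  have e2 := lintegral_past (μ := μ) h.1 t
    fun u => B u * ∑' w, ENNReal.ofReal (P 0 p (u (Fin.last t)) w) * F w
  refine e1.trans (Eq.trans ?_ e2.symm)
  rw [← (Fin.snocEquiv fun _ : Fin (t + 2) => Word).tsum_eq, ENNReal.tsum_prod', ENNReal.tsum_comm]
  refine tsum_congr fun u => ?_
  rw [← ENNReal.tsum_mul_left, ← ENNReal.tsum_mul_right]
  refine tsum_congr fun w => ?_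
  change B (Fin.init (Fin.snoc (α := fun _ => Word) u w)) *
    F (Fin.snoc (α := fun _ => Word) u w (Fin.last (t + 1))) *
      μ {ω | past ξ (t + 1) ω = Fin.snoc (α := fun _ => Word) u w} = _
  rw [measure_past_snoc h, Fin.init_snoc, Fin.snoc_last]
  ring

lemma lintegral_past_mul_ofReal (h : IsEVChain 0 p μ ξ) (hp0 : 0 ≤ p) (hp1 : p ≤ 1) (t : ℕ)
    (B : (Fin (t + 1) → Word) → ℝ≥0∞) {f : Word → ℝ} (hf : ∀ w, 0 ≤ f w) :
    ∫⁻ ω, B (past ξ t ω) * ENNReal.ofReal (f (ξ (t + 1) ω)) ∂μ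
      = ∫⁻ ω, B (past ξ t ω) * ENNReal.ofReal (mean p f (ξ t ω)) ∂μ := by
  rw [lintegral_past_mul h t B fun w => ENNReal.ofReal (f w)]
  simp only [tsum_P_mul hp0 hp1 hf]

lemma lintegral_ofReal_succ (h : IsEVChain 0 p μ ξ) (hp0 : 0 ≤ p) (hp1 : p ≤ 1) (t : ℕ)
    {f : Word → ℝ} (hf : ∀ w, 0 ≤ f w) :
    ∫⁻ ω, ENNReal.ofReal (f (ξ (t + 1) ω)) ∂μ
      = ∫⁻ ω, ENNReal.ofReal (mean p f (ξ t ω)) ∂μ := by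
  simpa using lintegral_past_mul_ofReal h hp0 hp1 t (fun _ => 1) hf

open scoped Classical in
lemma ae_isConfig (h : IsEVChain 0 p μ ξ) (hp0 : 0 ≤ p) (hp1 : p ≤ 1)
    (h0 : ∀ᵐ ω ∂μ, IsConfig (ξ 0 ω)) (t : ℕ) : ∀ᵐ ω ∂μ, IsConfig (ξ t ω) := by
  induction t with
  | zero => exact h0
  | succ t ih =>
    set f : Word → ℝ := fun w => if IsConfig w then 0 else 1 with hf
    have hf0 : ∀ w, 0 ≤ f w := fun w => by simp only [hf]; split_ifs <;> norm_num
    have h1 := lintegral_ofReal_succ h hp0 hp1 t hf0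
    have h2 : ∫⁻ ω, ENNReal.ofReal (mean p f (ξ t ω)) ∂μ = 0 := by
      rw [lintegral_eq_zero_iff (measurable_ofReal_comp h.1 _ t)]
      filter_upwards [ih] with ω hω
      have h3 : mean p f (ξ t ω) = mean p (fun w => 0 * f w) (ξ t ω) :=
        mean_congr (by simp [hf, hω]) fun i _ => by simp [hf, nbr, isConfig_strip]
      rw [h3, mean_const_mul]
      simp
    rw [h2, lintegral_eq_zero_iff (measurable_ofReal_comp h.1 _ (t + 1))] at h1
    filter_upwards [h1] with ω hω
    by_contra hc
    simp [hf, hc] at hω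

lemma measurableSet_alive (hξ : ∀ t, Measurable (ξ t)) (t : ℕ) : MeasurableSet (alive ξ t) := by
  simp only [alive, Set.ofPred_forall]
  exact .iInter fun i => .iInter fun _ => .iInter fun _ =>
    hξ i (MeasurableSet.of_discrete (s := {groundState}ᶜ))

/-- The expectation of `f (ξ (t + 1))` restricted to the event of not having relaxed. -/
noncomputable def aliveMean (μ : Measure Ω) (ξ : ℕ → Ω → Word) (f : Word → ℝ) (t : ℕ) : ℝ≥0∞ :=
  ∫⁻ ω, (alive ξ (t + 1)).indicator (fun _ => 1) ω * ENNReal.ofReal (f (ξ (t + 1) ω)) ∂μ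

lemma aliveMean_succ_le (h : IsEVChain 0 p μ ξ) (hp0 : 0 ≤ p) (hp1 : p ≤ 1) (t : ℕ)
    {f : Word → ℝ} (hf : ∀ w, 0 ≤ f w) :
    aliveMean μ ξ f (t + 1) ≤ aliveMean μ ξ (mean p f) t := by
  classical
  have h1 := lintegral_past_mul_ofReal h hp0 hp1 (t + 1)
    (fun u => if ∀ i : Fin (t + 2), 0 < (i : ℕ) → u i ≠ groundState then 1 else 0) hf
  have h2 : ∀ ω, (if ∀ i : Fin (t + 2), 0 < (i : ℕ) → past ξ (t + 1) ω i ≠ groundState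
      then (1 : ℝ≥0∞) else 0) = (alive ξ (t + 1)).indicator (fun _ => 1) ω := fun ω => by
    rw [Set.indicator_apply]
    refine if_congr ?_ rfl rfl
    exact ⟨fun H i hi hit => H ⟨i, by omega⟩ hi, fun H i hi => H i hi (by omega)⟩
  simp only [h2] at h1
  rw [aliveMean, aliveMean, ← h1]
  refine lintegral_mono fun ω => ?_
  gcongr ?_ * _
  exact Set.indicator_le_indicator_of_subset (alive_anti ξ (by omega)) (fun _ => zero_le_one) ω

lemma aliveMean_zero_lt_top [IsProbabilityMeasure μ] (h : IsEVChain 0 p μ ξ) (hp0 : 0 ≤ p)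
    (hp1 : p ≤ 1) {S₀ : Word} (hinit : ∀ᵐ ω ∂μ, ξ 0 ω = S₀) {f : Word → ℝ} (hf : ∀ w, 0 ≤ f w) :
    aliveMean μ ξ f 0 < ⊤ := by
  calc aliveMean μ ξ f 0 ≤ ∫⁻ ω, ENNReal.ofReal (f (ξ 1 ω)) ∂μ :=
        lintegral_mono fun ω => mul_le_of_le_one_left' (Set.indicator_le_self' (by simp) ω)
    _ = ∫⁻ ω, ENNReal.ofReal (mean p f (ξ 0 ω)) ∂μ := lintegral_ofReal_succ h hp0 hp1 0 hf
    _ = ∫⁻ _, ENNReal.ofReal (mean p f S₀) ∂μ :=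
        lintegral_congr_ae (by filter_upwards [hinit] with ω hω; rw [hω])
    _ < ⊤ := by simp

lemma aliveMean_drift (h : IsEVChain 0 p μ ξ) (hp0 : 0 ≤ p) (hp1 : p ≤ 1)
    (h0 : ∀ᵐ ω ∂μ, IsConfig (ξ 0 ω)) (t : ℕ) {U V : Word → ℝ} (hU : ∀ w, 0 ≤ U w)
    (hV : ∀ w, 0 ≤ V w) (hUV : ∀ w, IsConfig w → w ≠ [] → mean p U w + V w ≤ U w) :
    aliveMean μ ξ U (t + 1) + aliveMean μ ξ V t ≤ aliveMean μ ξ U t := by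
  refine (add_le_add_left (aliveMean_succ_le h hp0 hp1 t hU) _).trans ?_
  have hm : Measurable fun ω => (alive ξ (t + 1)).indicator (fun _ => (1 : ℝ≥0∞)) ω *
      ENNReal.ofReal (mean p U (ξ (t + 1) ω)) :=
    (measurable_const.indicator (measurableSet_alive h.1 _)).mul
      (measurable_ofReal_comp h.1 _ (t + 1))
  rw [aliveMean, aliveMean, ← lintegral_add_left hm]
  refine lintegral_mono_ae ?_
  filter_upwards [ae_isConfig h hp0 hp1 h0 (t + 1)] with ω hω
  by_cases hA : ω ∈ alive ξ (t + 1)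
  · simp only [Set.indicator_of_mem hA, one_mul]
    rw [← ENNReal.ofReal_add (mean_nonneg hp0 hp1 hU _) (hV _)]
    exact ENNReal.ofReal_le_ofReal (hUV _ hω (hA (t + 1) (by omega) le_rfl))
  · simp [hA]

end Chain

lemma add_one_pow_le (t j : ℕ) : (t + 1) ^ (j + 1) ≤ t ^ (j + 1) + (j + 1) * (t + 1) ^ j := by
  induction j with
  | zero => simp
  | succ j ih =>
    have h : t * (t + 1) ^ j ≤ (t + 1) ^ (j + 1) := by
      rw [pow_succ' (t + 1)]; gcongr; omega
    calc (t + 1) ^ (j + 2) = t * (t + 1) ^ (j + 1) + (t + 1) ^ (j + 1) := by ring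
      _ ≤ t * (t ^ (j + 1) + (j + 1) * (t + 1) ^ j) + (t + 1) ^ (j + 1) := by gcongr
      _ = t ^ (j + 2) + (j + 1) * (t * (t + 1) ^ j) + (t + 1) ^ (j + 1) := by ring
      _ ≤ t ^ (j + 2) + (j + 1) * (t + 1) ^ (j + 1) + (t + 1) ^ (j + 1) := by gcongr
      _ = _ := by ring

lemma sum_pow_mul_le (j T : ℕ) {b β : ℕ → ℝ≥0∞} (h : ∀ t, β (t + 1) + b t ≤ β t) :
    ∑ t ∈ Finset.range T, ((t : ℝ≥0∞) + 1) ^ (j + 1) * b t + (T : ℝ≥0∞) ^ (j + 1) * β T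
      ≤ ∑ t ∈ Finset.range T, (j + 1) * ((t : ℝ≥0∞) + 1) ^ j * β t := by
  have hpow : ∀ t : ℕ, ((t : ℝ≥0∞) + 1) ^ (j + 1) ≤ (t : ℝ≥0∞) ^ (j + 1)
      + (j + 1) * ((t : ℝ≥0∞) + 1) ^ j := fun t => by
    exact_mod_cast add_one_pow_le t j
  induction T with
  | zero => simp
  | succ T ih =>
    rw [Finset.sum_range_succ, Finset.sum_range_succ]
    calc _ = ∑ t ∈ Finset.range T, ((t : ℝ≥0∞) + 1) ^ (j + 1) * b t
          + ((T : ℝ≥0∞) + 1) ^ (j + 1) * (β (T + 1) + b T) := by push_cast; ring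
      _ ≤ ∑ t ∈ Finset.range T, ((t : ℝ≥0∞) + 1) ^ (j + 1) * b t
          + ((T : ℝ≥0∞) ^ (j + 1) + (j + 1) * ((T : ℝ≥0∞) + 1) ^ j) * β T := by
          gcongr
          · exact hpow T
          · exact h T
      _ = (∑ t ∈ Finset.range T, ((t : ℝ≥0∞) + 1) ^ (j + 1) * b t
          + (T : ℝ≥0∞) ^ (j + 1) * β T) + (j + 1) * ((T : ℝ≥0∞) + 1) ^ j * β T := by ring
      _ ≤ _ := by gcongr

/-- Iterated drift conditions, each level dominated by the next, force polynomial decay. -/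
lemma tsum_pow_mul_lt_top {b : ℕ → ℕ → ℝ≥0∞} (h0 : ∀ k, b k 0 < ⊤)
    (hb : ∀ k, ∃ (C : ℝ≥0∞) (β : ℕ → ℝ≥0∞), C ≠ ⊤ ∧ (∀ t, β t ≤ C * b (k + 1) t) ∧
      ∀ t, β (t + 1) + b k t ≤ β t) (j k : ℕ) :
    ∑' t : ℕ, ((t : ℝ≥0∞) + 1) ^ j * b k t < ⊤ := by
  induction j generalizing k with
  | zero =>
    obtain ⟨C, β, hC, h1, h2⟩ := hb k
    have h3 : ∀ T, ∑ t ∈ Finset.range T, b k t + β T ≤ β 0 := fun T => by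
      induction T with
      | zero => simp
      | succ T ih =>
        rw [Finset.sum_range_succ, add_assoc, add_comm (b k T)]
        exact (add_le_add_right (h2 T) _).trans ih
    simp only [pow_zero, one_mul]
    rw [ENNReal.tsum_eq_iSup_nat]
    refine (iSup_le fun T => le_self_add.trans (h3 T)).trans_lt ?_
    exact (h1 0).trans_lt (ENNReal.mul_lt_top hC.lt_top (h0 (k + 1)))
  | succ j ih =>
    obtain ⟨C, β, hC, h1, h2⟩ := hb k
    rw [ENNReal.tsum_eq_iSup_nat]
    refine (iSup_le fun T => ?_).trans_lt
      (ENNReal.mul_lt_top (a := (j + 1) * C) (ENNReal.mul_lt_top (by finiteness) hC.lt_top)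
        (ih (k + 1)))
    calc _ ≤ ∑ t ∈ Finset.range T, (j + 1) * ((t : ℝ≥0∞) + 1) ^ j * β t :=
          le_self_add.trans (sum_pow_mul_le j T h2)
      _ ≤ ∑ t ∈ Finset.range T, ((j + 1) * C) * (((t : ℝ≥0∞) + 1) ^ j * b (k + 1) t) := by
          refine Finset.sum_le_sum fun t _ => ?_
          calc _ ≤ (j + 1) * ((t : ℝ≥0∞) + 1) ^ j * (C * b (k + 1) t) := by gcongr; exact h1 t
            _ = _ := by ring
      _ ≤ _ := by
          rw [← Finset.mul_sum]
          gcongr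
          exact ENNReal.sum_le_tsum _

lemma relaxTime_rpow_le {Ω : Type*} (ξ : ℕ → Ω → Word) (ω : Ω) {s : ℝ} (hs : 0 ≤ s) {j : ℕ}
    (hj : s ≤ j) :
    relaxTime ξ ω ^ s ≤ 1 + 2 ^ j * ∑' t : ℕ, ((t : ℝ≥0∞) + 1) ^ j *
      (alive ξ (t + 1)).indicator (fun _ => 1) ω := by
  classical
  by_cases hτ : ∃ t, 0 < t ∧ ξ t ω = groundState
  · obtain ⟨hm0, hm⟩ := Nat.find_spec hτ
    have hmin : ∀ i, 0 < i → i < Nat.find hτ → ξ i ω ≠ groundState :=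
      fun i hi him he => Nat.find_min hτ him ⟨hi, he⟩
    generalize Nat.find hτ = m at hm0 hm hmin
    have h1 : relaxTime ξ ω ≤ m := sInf_le ⟨m, hm0, hm, rfl⟩
    have h2 : relaxTime ξ ω ^ s ≤ (m : ℝ≥0∞) ^ j := by
      rw [← ENNReal.rpow_natCast]
      exact (ENNReal.rpow_le_rpow h1 hs).trans
        (ENNReal.rpow_le_rpow_of_exponent_le (by exact_mod_cast hm0) hj)
    refine h2.trans ?_
    obtain rfl | ⟨t, rfl⟩ : m = 1 ∨ ∃ t, m = t + 2 := by
      rcases m with _ | _ | t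
      · omega
      · exact .inl rfl
      · exact .inr ⟨t, rfl⟩
    · simp
    · have hA : ω ∈ alive ξ (t + 1) := fun i hi hit => hmin i hi (by omega)
      calc ((t + 2 : ℕ) : ℝ≥0∞) ^ j ≤ 2 ^ j * (((t : ℝ≥0∞) + 1) ^ j *
            (alive ξ (t + 1)).indicator (fun _ => 1) ω) := by
            rw [Set.indicator_of_mem hA, mul_one, ← mul_pow]
            gcongr
            exact_mod_cast (by omega : t + 2 ≤ 2 * (t + 1))
        _ ≤ _ := by
            refine le_add_left ?_
            gcongr
            exact ENNReal.le_tsum (f := fun t : ℕ => ((t : ℝ≥0∞) + 1) ^ j *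
              (alive ξ (t + 1)).indicator (fun _ => 1) ω) t
  · push Not at hτ
    have h1 : ∑' t : ℕ, ((t : ℝ≥0∞) + 1) ^ j * (alive ξ (t + 1)).indicator (fun _ => 1) ω = ⊤ := by
      refine top_unique ?_
      rw [← ENNReal.tsum_const_eq_top_of_ne_zero (α := ℕ) one_ne_zero]
      refine ENNReal.tsum_le_tsum fun t => ?_
      have hA : ω ∈ alive ξ (t + 1) := fun i hi _ => hτ i hi
      rw [Set.indicator_of_mem hA, mul_one]
      exact one_le_pow₀ (by simp)
    rw [h1, ENNReal.mul_top (by simp)]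
    simp

/-- Theorem 5: for pure exclusion (`β = 0`) with `p > 1/2`, all polynomial moments of
the relaxation time are finite: `E_{0,p}[τ^s | ξ₀ = S₀] < ∞` for every `s ∈ [0,∞)`. -/
theorem relaxTime_all_moments_finite_pure_exclusion
    (p : ℝ) (hp : 1 / 2 < p) (hp1 : p ≤ 1)
    (S₀ : Word) (hS₀ : IsConfig S₀)
    {Ω : Type*} [MeasurableSpace Ω] (μ : Measure Ω) [IsProbabilityMeasure μ]
    (ξ : ℕ → Ω → Word) (hchain : IsEVChain 0 p μ ξ)
    (hinit : ∀ᵐ ω ∂μ, ξ 0 ω = S₀) :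
    ∀ s : ℝ, 0 ≤ s → ∫⁻ ω, relaxTime ξ ω ^ s ∂μ < ⊤ := by

  intro s hs
  have hp0 : 0 ≤ p := by linarith
  have hconf : ∀ᵐ ω ∂μ, IsConfig (ξ 0 ω) := by
    filter_upwards [hinit] with ω hω
    rwa [hω]
  have hw : ∀ k w, 0 ≤ weight k w := fun k w => zero_le_one.trans (one_le_weight k w)
  obtain ⟨j, hj⟩ := exists_nat_ge s
  have hsum : ∑' t : ℕ, ((t : ℝ≥0∞) + 1) ^ j * aliveMean μ ξ (weight 0) t < ⊤ := by
    refine tsum_pow_mul_lt_top (b := fun k => aliveMean μ ξ (weight k))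
      (fun k => aliveMean_zero_lt_top hchain hp0 hp1 hinit (hw k)) (fun k => ?_) j 0
    obtain ⟨U, C, hC, hU, hUC, hdrift⟩ := exists_lyapunov hp hp1 k
    refine ⟨ENNReal.ofReal C, aliveMean μ ξ U, ENNReal.ofReal_ne_top, fun t => ?_,
      fun t => aliveMean_drift hchain hp0 hp1 hconf t hU (hw k) hdrift⟩
    rw [aliveMean, aliveMean, ← lintegral_const_mul' _ _ ENNReal.ofReal_ne_top]
    refine lintegral_mono fun ω => ?_
    rw [mul_left_comm, ← ENNReal.ofReal_mul hC]
    gcongr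
    exact hUC _
  have hmeas : ∀ t, Measurable ((alive ξ t).indicator fun _ => (1 : ℝ≥0∞)) := fun t =>
    measurable_const.indicator (measurableSet_alive hchain.1 t)
  calc ∫⁻ ω, relaxTime ξ ω ^ s ∂μ
      ≤ ∫⁻ ω, 1 + 2 ^ j * ∑' t : ℕ, ((t : ℝ≥0∞) + 1) ^ j *
          (alive ξ (t + 1)).indicator (fun _ => 1) ω ∂μ :=
        lintegral_mono fun ω => relaxTime_rpow_le ξ ω hs hj
    _ = 1 + 2 ^ j * ∑' t : ℕ, ((t : ℝ≥0∞) + 1) ^ j * aliveMean μ ξ (weight 0) t := by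
        rw [lintegral_add_left measurable_const, lintegral_const_mul' _ _ (by finiteness),
          lintegral_tsum fun t => ((hmeas (t + 1)).const_mul _).aemeasurable]
        simp only [lintegral_const, measure_univ, mul_one]
        congr 2
        refine tsum_congr fun t => ?_
        rw [lintegral_const_mul _ (hmeas (t + 1)), aliveMean]
        simp [weight]
    _ < ⊤ :=
        ENNReal.add_lt_top.2 ⟨ENNReal.one_lt_top, ENNReal.mul_lt_top (by finiteness) hsum⟩

end EV
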